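/- The graph Δ_3 is girth-regular with signature (4, 5, 5), and for every integer n ≥ 4 the graph Δ_n is girth-regular with signature (2, 3, 3); that is, for n ≥ 4 every vertex of Δ_n is incident to exactly one edge lying on exactly 2 six-cycles and two edges lying on exactly 3 six-cycles each. -/

import Mathlib

/-- The Cayley graph of a group on a (symmetric) connection set `S`:
distinct `g, h` are adjacent iff `g * h⁻¹ ∈ S`. -/
def cayley {G : Type*} [Group G] (S : Set G) : SimpleGraph G :=
  SimpleGraph.fromRel (fun x y => x * y⁻¹ ∈ S)

/-- In the dihedral group `D_n = ⟨ρ, τ⟩`, the element `τ_i = ρ^i * τ`. -/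
def dihTau {n : ℕ} (i : ℕ) : DihedralGroup n :=
  (DihedralGroup.r 1) ^ i * DihedralGroup.sr 0

/-- The graph `Δ_n = Cay(D_{3n}, {τ_0, τ_k, τ_n})`, where `k = 3 / gcd(3, n)`. -/
def deltaGraph (n : ℕ) : SimpleGraph (DihedralGroup (3 * n)) :=
  cayley ({dihTau 0, dihTau (3 / Nat.gcd 3 n), dihTau n} : Set (DihedralGroup (3 * n)))

/-- The number of cycles of length 6 in `G` (identified with their edge sets)
that contain the edge `e`. -/
noncomputable def sixCycleCount {V : Type*} (G : SimpleGraph V) (e : Sym2 V) : ℕ :=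
  Set.ncard {s : Set (Sym2 V) |
    (∃ (v : V) (w : G.Walk v v), w.IsCycle ∧ w.length = 6 ∧ s = {e' | e' ∈ w.edges}) ∧ e ∈ s}

open DihedralGroup in
/-- A simple graph on a dihedral group is a Haar graph with symbol `f` when its edges join
`r i` to `sr (i - f a)`. -/
structure IsHaar {m : ℕ} (G : SimpleGraph (DihedralGroup m)) (f : Fin 3 → ZMod m) : Prop where
  injective : Function.Injective f
  adj_r_sr : ∀ i j, G.Adj (r i) (sr j) ↔ ∃ a, j = i - f a
  not_adj_r_r : ∀ i j, ¬ G.Adj (r i) (r j)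
  not_adj_sr_sr : ∀ i j, ¬ G.Adj (sr i) (sr j)

/-- The closed walk `x, y, p, q, u, v, x` is a six-cycle. -/
def IsHexagon {V : Type*} (G : SimpleGraph V) (x y p q u v : V) : Prop :=
  (G.Adj x y ∧ G.Adj y p ∧ G.Adj p q ∧ G.Adj q u ∧ G.Adj u v ∧ G.Adj v x) ∧
    [x, y, p, q, u, v].Nodup

/-- The edges of the closed walk `x, y, p, q, u, v, x`. -/
def hexagonEdges {V : Type*} (x y p q u v : V) : Set (Sym2 V) :=
  {s(x, y), s(y, p), s(p, q), s(q, u), s(u, v), s(v, x)}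

theorem IsHexagon.rotate {V : Type*} {G : SimpleGraph V} {x y p q u v : V}
    (h : IsHexagon G x y p q u v) : IsHexagon G y p q u v x := by
  obtain ⟨⟨h1, h2, h3, h4, h5, h6⟩, hd⟩ := h
  refine ⟨⟨h2, h3, h4, h5, h6, h1⟩, ?_⟩
  simp only [List.nodup_cons, List.mem_cons, List.not_mem_nil] at hd ⊢
  grind

theorem IsHexagon.reverse {V : Type*} {G : SimpleGraph V} {x y p q u v : V}
    (h : IsHexagon G x y p q u v) : IsHexagon G y x v u q p := by
  obtain ⟨⟨h1, h2, h3, h4, h5, h6⟩, hd⟩ := h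
  refine ⟨⟨h1.symm, h6.symm, h5.symm, h4.symm, h3.symm, h2.symm⟩, ?_⟩
  simp only [List.nodup_cons, List.mem_cons, List.not_mem_nil] at hd ⊢
  grind

theorem hexagonEdges_rotate {V : Type*} (x y p q u v : V) :
    hexagonEdges y p q u v x = hexagonEdges x y p q u v := by
  ext e
  simp only [hexagonEdges, Set.mem_insert_iff, Set.mem_singleton_iff]
  tauto

theorem hexagonEdges_reverse {V : Type*} (x y p q u v : V) :
    hexagonEdges y x v u q p = hexagonEdges x y p q u v := by
  ext e
  simp only [hexagonEdges, Set.mem_insert_iff, Set.mem_singleton_iff, Sym2.eq_swap (a := y) (b := x),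
    Sym2.eq_swap (a := x) (b := v), Sym2.eq_swap (a := v) (b := u), Sym2.eq_swap (a := u) (b := q),
    Sym2.eq_swap (a := q) (b := p), Sym2.eq_swap (a := p) (b := y)]
  tauto

theorem exists_isCycle_length_six_iff {V : Type*} (G : SimpleGraph V) (s : Set (Sym2 V)) :
    (∃ (v : V) (w : G.Walk v v), w.IsCycle ∧ w.length = 6 ∧ s = {e' | e' ∈ w.edges}) ↔
      ∃ x y p q u v, IsHexagon G x y p q u v ∧ s = hexagonEdges x y p q u v := by
  constructor
  · rintro ⟨x, w, hw, hl, rfl⟩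
    match w, hl with
    | .cons (v := y) h1 (.cons (v := p) h2 (.cons (v := q) h3 (.cons (v := u) h4
        (.cons (v := v) h5 (.cons h6 .nil))))), _ =>
      refine ⟨x, y, p, q, u, v, ⟨⟨h1, h2, h3, h4, h5, h6⟩, ?_⟩, ?_⟩
      · have := hw.support_nodup
        simp only [SimpleGraph.Walk.support_cons, SimpleGraph.Walk.support_nil, List.tail_cons,
          List.nodup_cons, List.mem_cons, List.not_mem_nil] at this ⊢
        grind
      · ext e
        simp [hexagonEdges]
  · rintro ⟨x, y, p, q, u, v, ⟨⟨h1, h2, h3, h4, h5, h6⟩, hd⟩, rfl⟩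
    refine ⟨x, .cons h1 (.cons h2 (.cons h3 (.cons h4 (.cons h5 (.cons h6 .nil))))), ?_, rfl, ?_⟩
    · simp only [List.nodup_cons, List.mem_cons, List.not_mem_nil] at hd
      rw [SimpleGraph.Walk.cons_isCycle_iff]
      simp [SimpleGraph.Walk.cons_isPath_iff]
      grind
    · ext e
      simp [hexagonEdges]

theorem hexagonEdges_injOn {V : Type*} (G : SimpleGraph V) (x y : V) :
    Set.InjOn (fun t : V × V × V × V => hexagonEdges x y t.1 t.2.1 t.2.2.1 t.2.2.2)
      {t | IsHexagon G x y t.1 t.2.1 t.2.2.1 t.2.2.2} := by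
  rintro ⟨p, q, u, v⟩ ⟨-, hd⟩ ⟨p', q', u', v'⟩ ⟨-, hd'⟩ heq
  simp only [List.nodup_cons, List.mem_cons, List.not_mem_nil] at hd hd' heq
  have key : ∀ e, e ∈ hexagonEdges x y p' q' u' v' → e ∈ hexagonEdges x y p q u v :=
    fun e he => heq ▸ he
  have h1 := key s(y, p') (by simp [hexagonEdges])
  have h2 := key s(p', q') (by simp [hexagonEdges])
  have h3 := key s(q', u') (by simp [hexagonEdges])
  have h4 := key s(u', v') (by simp [hexagonEdges])
  simp only [hexagonEdges, Set.mem_insert_iff, Set.mem_singleton_iff, Sym2.eq_iff] at h1 h2 h3 h4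
  obtain rfl : p' = p := by grind
  obtain rfl : q' = q := by grind
  obtain rfl : u' = u := by grind
  obtain rfl : v' = v := by grind
  rfl

theorem sixCycleCount_eq_ncard {V : Type*} (G : SimpleGraph V) (x y : V) :
    sixCycleCount G s(x, y) =
      Set.ncard {t : V × V × V × V | IsHexagon G x y t.1 t.2.1 t.2.2.1 t.2.2.2} := by
  rw [sixCycleCount, ← (hexagonEdges_injOn G x y).ncard_image]
  congr 1
  ext s
  simp only [exists_isCycle_length_six_iff, Set.mem_ofPred_eq, Set.mem_image, Prod.exists]
  constructor
  · rintro ⟨⟨a, b, c, d, e, g, h, rfl⟩, hmem⟩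
    have oriented : ∀ a b c d e g, IsHexagon G a b c d e g → s(x, y) = s(a, b) →
        ∃ p q u v, IsHexagon G x y p q u v ∧
          hexagonEdges x y p q u v = hexagonEdges a b c d e g := by
      intro a b c d e g h hxy
      rcases Sym2.eq_iff.1 hxy with ⟨rfl, rfl⟩ | ⟨rfl, rfl⟩
      · exact ⟨_, _, _, _, h, rfl⟩
      · exact ⟨_, _, _, _, h.reverse, hexagonEdges_reverse ..⟩
    have h1 := h.rotate
    have h2 := h1.rotate
    have h3 := h2.rotate
    have h4 := h3.rotate
    have h5 := h4.rotate
    have e1 := hexagonEdges_rotate a b c d e g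
    have e2 := (hexagonEdges_rotate b c d e g a).trans e1
    have e3 := (hexagonEdges_rotate c d e g a b).trans e2
    have e4 := (hexagonEdges_rotate d e g a b c).trans e3
    have e5 := (hexagonEdges_rotate e g a b c d).trans e4
    rcases hmem with hm | hm | hm | hm | hm | hm
    · exact oriented _ _ _ _ _ _ h hm
    · exact e1 ▸ oriented _ _ _ _ _ _ h1 hm
    · exact e2 ▸ oriented _ _ _ _ _ _ h2 hm
    · exact e3 ▸ oriented _ _ _ _ _ _ h3 hm
    · exact e4 ▸ oriented _ _ _ _ _ _ h4 hm
    · exact e5 ▸ oriented _ _ _ _ _ _ h5 hm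
  · rintro ⟨p, q, u, v, h, rfl⟩
    exact ⟨⟨_, _, _, _, _, _, h, rfl⟩, Or.inl rfl⟩

/-- The label `(b, c, d, e, g)` completes `a` to a cyclically reduced word of length six. -/
def IsReducedLabel (a : Fin 3) (t : Fin 3 × Fin 3 × Fin 3 × Fin 3 × Fin 3) : Prop :=
  a ≠ t.1 ∧ t.1 ≠ t.2.1 ∧ t.2.1 ≠ t.2.2.1 ∧ t.2.2.1 ≠ t.2.2.2.1 ∧ t.2.2.2.1 ≠ t.2.2.2.2 ∧
    t.2.2.2.2 ≠ a

instance (a : Fin 3) : DecidablePred (IsReducedLabel a) := fun _ =>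
  inferInstanceAs (Decidable (_ ∧ _))

/-- The alternating sum of `f` along a word of length six. -/
def alternatingSum {R : Type*} [Ring R] (f : Fin 3 → R) (a : Fin 3)
    (t : Fin 3 × Fin 3 × Fin 3 × Fin 3 × Fin 3) : R :=
  f a - f t.1 + f t.2.1 - f t.2.2.1 + f t.2.2.2.1 - f t.2.2.2.2

open DihedralGroup in
theorem IsHaar.sixCycleCount_eq {m : ℕ} {G : SimpleGraph (DihedralGroup m)}
    {f : Fin 3 → ZMod m} (h : IsHaar G f) (i : ZMod m) (a : Fin 3) :
    sixCycleCount G s(r i, sr (i - f a)) =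
      Set.ncard {t | IsReducedLabel a t ∧ alternatingSum f a t = 0} := by
  have inj : ∀ {a b}, f a = f b ↔ a = b := h.injective.eq_iff
  have adj' : ∀ j i, G.Adj (sr j) (r i) ↔ ∃ a, j = i - f a := fun j i => by
    rw [G.adj_comm, h.adj_r_sr]
  rw [sixCycleCount_eq_ncard]
  let L : Fin 3 × Fin 3 × Fin 3 × Fin 3 × Fin 3 →
      DihedralGroup m × DihedralGroup m × DihedralGroup m × DihedralGroup m := fun t =>
    (r (i - f a + f t.1), sr (i - f a + f t.1 - f t.2.1),
      r (i - f a + f t.1 - f t.2.1 + f t.2.2.1),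
      sr (i - f a + f t.1 - f t.2.1 + f t.2.2.1 - f t.2.2.2.1))
  have hL : Set.InjOn L {t | IsReducedLabel a t ∧ alternatingSum f a t = 0} := by
    rintro ⟨b, c, d, e, g⟩ ⟨-, ht⟩ ⟨b', c', d', e', g'⟩ ⟨-, ht'⟩ heq
    simp only [L, Prod.mk.injEq, r.injEq, sr.injEq, alternatingSum] at heq ht ht'
    obtain ⟨h1, h2, h3, h4⟩ := heq
    obtain rfl : b = b' := inj.1 (by linear_combination h1)
    obtain rfl : c = c' := inj.1 (by linear_combination -h2)
    obtain rfl : d = d' := inj.1 (by linear_combination h3)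
    obtain rfl : e = e' := inj.1 (by linear_combination -h4)
    obtain rfl : g = g' := inj.1 (by linear_combination ht' - ht)
    rfl
  rw [← hL.ncard_image]
  congr 1
  ext ⟨p, q, u, v⟩
  simp only [Set.mem_ofPred_eq, Set.mem_image, Prod.exists, IsHexagon, IsReducedLabel,
    alternatingSum, L, Prod.mk.injEq]
  constructor
  · rintro ⟨⟨-, h2, h3, h4, h5, h6⟩, hd⟩
    rcases p with p | p
    swap
    · exact absurd h2 (h.not_adj_sr_sr _ _)
    rcases q with q | q
    · exact absurd h3 (h.not_adj_r_r _ _)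
    rcases u with u | u
    swap
    · exact absurd h4 (h.not_adj_sr_sr _ _)
    rcases v with v | v
    · exact absurd h5 (h.not_adj_r_r _ _)
    obtain ⟨b, hb⟩ := (adj' _ _).1 h2
    obtain ⟨c, hc⟩ := (h.adj_r_sr _ _).1 h3
    obtain ⟨d, hd'⟩ := (adj' _ _).1 h4
    obtain ⟨e, he⟩ := (h.adj_r_sr _ _).1 h5
    obtain ⟨g, hg⟩ := (adj' _ _).1 h6
    obtain rfl : p = i - f a + f b := by linear_combination -hb
    obtain rfl : q = i - f a + f b - f c := by linear_combination hc
    obtain rfl : u = i - f a + f b - f c + f d := by linear_combination -hd'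
    obtain rfl : v = i - f a + f b - f c + f d - f e := by linear_combination he
    refine ⟨b, c, d, e, g, ⟨⟨?_, ?_, ?_, ?_, ?_, ?_⟩, by linear_combination -hg⟩, rfl, rfl, rfl, rfl⟩
    all_goals
      rintro rfl
      simp only [List.nodup_cons, List.mem_cons, List.not_mem_nil, r.injEq, sr.injEq] at hd
      grind
  · rintro ⟨b, c, d, e, g, ⟨⟨h1, h2, h3, h4, h5, h6⟩, hs⟩, rfl, rfl, rfl, rfl⟩
    rw [← inj.ne] at h1 h2 h3 h4 h5 h6
    refine ⟨⟨(h.adj_r_sr _ _).2 ⟨a, rfl⟩, (adj' _ _).2 ⟨b, by ring⟩, (h.adj_r_sr _ _).2 ⟨c, by ring⟩,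
      (adj' _ _).2 ⟨d, by ring⟩, (h.adj_r_sr _ _).2 ⟨e, by ring⟩,
      (adj' _ _).2 ⟨g, by linear_combination -hs⟩⟩, ?_⟩
    simp only [List.nodup_cons, List.mem_cons, List.not_mem_nil, r.injEq, sr.injEq, reduceCtorEq,
      or_false, false_or, not_or, not_false_eq_true, List.nodup_nil, and_true, or_self]
    refine ⟨⟨?_, ?_⟩, ⟨?_, ?_⟩, ?_, ?_⟩ <;> intro h0
    · exact h1 (by linear_combination h0)
    · exact h5 (by grind)
    · exact h2 (by grind)
    · exact h6 (by grind)
    · exact h3 (by grind)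
    · exact h4 (by grind)

open DihedralGroup in
theorem IsHaar.ncard_incidenceSet {m : ℕ} {G : SimpleGraph (DihedralGroup m)}
    {f : Fin 3 → ZMod m} (h : IsHaar G f) {N : Fin 3 → ℕ}
    (hN : ∀ i a, sixCycleCount G s(r i, sr (i - f a)) = N a) (v : DihedralGroup m) (c : ℕ) :
    Set.ncard {e ∈ G.incidenceSet v | sixCycleCount G e = c} =
      (Finset.univ.filter fun a => N a = c).card := by
  obtain ⟨F, hF, hinc, hcount⟩ : ∃ F : Fin 3 → Sym2 (DihedralGroup m), Function.Injective F ∧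
      (∀ e, e ∈ G.incidenceSet v ↔ ∃ a, F a = e) ∧ ∀ a, sixCycleCount G (F a) = N a := by
    rcases v with i | j
    · refine ⟨fun a => s(r i, sr (i - f a)), fun a b hab => h.injective ?_, fun e => ?_, hN i⟩
      · simpa using hab
      · constructor
        · rintro ⟨he, hv⟩
          obtain ⟨w, rfl⟩ := Sym2.mem_iff_exists.1 hv
          rw [SimpleGraph.mem_edgeSet] at he
          rcases w with w | w
          · exact absurd he (h.not_adj_r_r _ _)
          · obtain ⟨a, rfl⟩ := (h.adj_r_sr _ _).1 he
            exact ⟨a, rfl⟩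
        · rintro ⟨a, rfl⟩
          exact ⟨(h.adj_r_sr _ _).2 ⟨a, rfl⟩, Sym2.mem_mk_left _ _⟩
    · refine ⟨fun a => s(r (j + f a), sr j), fun a b hab => h.injective ?_, fun e => ?_,
        fun a => by simpa using hN (j + f a) a⟩
      · simpa using hab
      · constructor
        · rintro ⟨he, hv⟩
          obtain ⟨w, rfl⟩ := Sym2.mem_iff_exists.1 hv
          rw [SimpleGraph.mem_edgeSet] at he
          rcases w with w | w
          · obtain ⟨a, rfl⟩ := (h.adj_r_sr _ _).1 he.symm
            exact ⟨a, by simp [Sym2.eq_swap]⟩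
          · exact absurd he (h.not_adj_sr_sr _ _)
        · rintro ⟨a, rfl⟩
          exact ⟨(h.adj_r_sr _ _).2 ⟨a, by simp⟩, Sym2.mem_mk_right _ _⟩
  rw [← Set.ncard_coe_finset, ← Set.ncard_image_of_injective _ hF]
  congr 1
  ext e
  simp only [Set.mem_ofPred_eq, hinc, Finset.coe_filter, Finset.mem_univ, true_and, Set.mem_image]
  constructor
  · rintro ⟨⟨a, rfl⟩, hc⟩
    exact ⟨a, (hcount a).symm.trans hc, rfl⟩
  · rintro ⟨a, hc, rfl⟩
    exact ⟨⟨a, rfl⟩, (hcount a).trans hc⟩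

/-- The symbol of `Δ_n`. -/
def deltaSymbol (n : ℕ) : Fin 3 → ZMod (3 * n) :=
  ![0, (3 / Nat.gcd 3 n : ℕ), n]

theorem dihTau_eq_sr {m : ℕ} (i : ℕ) : (dihTau i : DihedralGroup m) = .sr (-i) := by
  simp [dihTau, DihedralGroup.r_mul_sr]

open DihedralGroup in
theorem deltaGraph_isHaar {n : ℕ} (hf : Function.Injective (deltaSymbol n)) :
    IsHaar (deltaGraph n) (deltaSymbol n) where
  injective := hf
  adj_r_sr i j := by
    have key : ∀ a, (j - i = -a ↔ j = i - a) := fun a => by grind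
    have key' : ∀ a, (j + -i = -a ↔ j = i - a) := fun a => by grind
    have key₀ : j - i = 0 ↔ j = i := sub_eq_zero
    have key₀' : j + -i = 0 ↔ j = i := by rw [← sub_eq_add_neg, sub_eq_zero]
    simp [deltaGraph, cayley, dihTau_eq_sr, deltaSymbol, Fin.exists_fin_succ, key, key', key₀, key₀']
  not_adj_r_r i j := by
    simp [deltaGraph, cayley, dihTau_eq_sr]
  not_adj_sr_sr i j := by
    simp [deltaGraph, cayley, dihTau_eq_sr]

/-- The coefficient of `k` in the symbol of `Δ_n`. -/
def coeffK : Fin 3 → ℤ := ![0, 1, 0]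

/-- The coefficient of `n` in the symbol of `Δ_n`. -/
def coeffN : Fin 3 → ℤ := ![0, 0, 1]

theorem deltaSymbol_eq (n : ℕ) (a : Fin 3) :
    deltaSymbol n a = coeffK a * (3 / Nat.gcd 3 n : ℕ) + coeffN a * n := by
  fin_cases a <;> simp [deltaSymbol, coeffK, coeffN]

theorem combination_eq_zero_iff (n : ℕ) (c d : ℤ) :
    (c * (3 / Nat.gcd 3 n : ℕ) + d * n : ZMod (3 * n)) = 0 ↔
      (3 * n : ℤ) ∣ c * (3 / Nat.gcd 3 n : ℕ) + d * n := by
  generalize 3 / Nat.gcd 3 n = k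
  exact_mod_cast ZMod.intCast_zmod_eq_zero_iff_dvd (c * k + d * n) (3 * n)

theorem alternatingSum_deltaSymbol_eq_zero_iff (n : ℕ) (a : Fin 3)
    (t : Fin 3 × Fin 3 × Fin 3 × Fin 3 × Fin 3) :
    alternatingSum (deltaSymbol n) a t = 0 ↔
      (3 * n : ℤ) ∣ alternatingSum coeffK a t * (3 / Nat.gcd 3 n : ℕ) +
        alternatingSum coeffN a t * n := by
  rw [← combination_eq_zero_iff]
  simp only [alternatingSum, deltaSymbol_eq]
  push_cast
  ring_nf

theorem three_mul_dvd_combination_iff {n : ℕ} (hn : 4 ≤ n) {c : ℤ} (hc : |c| ≤ 3) (d : ℤ) :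
    (3 * n : ℤ) ∣ c * (3 / Nat.gcd 3 n : ℕ) + d * n ↔ c = 0 ∧ 3 ∣ d := by
  have hn0 : (n : ℤ) ≠ 0 := by omega
  have small : (n : ℤ) ∣ c → c = 0 := fun h =>
    Int.eq_zero_of_abs_lt_dvd h (by omega)
  refine ⟨fun h => ?_, ?_⟩
  · have h3 : c = 0 ∧ (3 * n : ℤ) ∣ d * n := by
      by_cases h3 : 3 ∣ n
      · rw [Nat.gcd_eq_left h3] at h
        have hc0 : c = 0 := small <| by
          have := (Dvd.intro_left 3 rfl : (n : ℤ) ∣ 3 * n).trans h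
          simpa using this
        exact ⟨hc0, by simpa [hc0] using h⟩
      · rw [(Nat.Prime.coprime_iff_not_dvd Nat.prime_three).2 h3] at h
        have h3d : (3 : ℤ) ∣ d := by
          have h' : (3 : ℤ) ∣ d * n := by
            have := (Dvd.intro _ rfl : (3 : ℤ) ∣ 3 * n).trans h
            omega
          refine (Int.prime_three.dvd_or_dvd h').resolve_right ?_
          exact_mod_cast h3
        have hdn : (3 * n : ℤ) ∣ d * n := mul_dvd_mul_right h3d _
        refine ⟨small ?_, hdn⟩
        have := (dvd_add_left hdn).1 h
        rw [mul_comm c] at this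
        exact Int.dvd_of_mul_dvd_mul_left three_ne_zero (by simpa using this)
    exact ⟨h3.1, Int.dvd_of_mul_dvd_mul_right hn0 h3.2⟩
  · rintro ⟨rfl, h⟩
    simpa using mul_dvd_mul_right h (n : ℤ)

theorem abs_alternatingSum_coeffK_le (a : Fin 3) (t : Fin 3 × Fin 3 × Fin 3 × Fin 3 × Fin 3) :
    |alternatingSum coeffK a t| ≤ 3 := by
  have h : ∀ a, 0 ≤ coeffK a ∧ coeffK a ≤ 1 := by decide
  rw [alternatingSum, abs_le]
  grind

theorem deltaSymbol_injective {n : ℕ} (hn : 3 ≤ n) : Function.Injective (deltaSymbol n) := by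
  rcases hn.eq_or_lt with rfl | hn
  · decide
  · intro a b hab
    have h0 : ((coeffK a - coeffK b : ℤ) * (3 / Nat.gcd 3 n : ℕ) +
        (coeffN a - coeffN b : ℤ) * n : ZMod (3 * n)) = 0 := by
      rw [deltaSymbol_eq, deltaSymbol_eq] at hab
      push_cast
      linear_combination hab
    have habs : |coeffK a - coeffK b| ≤ 3 := by clear hab h0; revert a b; decide
    rw [combination_eq_zero_iff, three_mul_dvd_combination_iff hn habs] at h0
    clear hab habs
    revert a b
    decide

theorem sixCycleCount_deltaGraph_three (i : ZMod (3 * 3)) (a : Fin 3) :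
    sixCycleCount (deltaGraph 3) s(.r i, .sr (i - deltaSymbol 3 a)) = ![5, 5, 4] a := by
  rw [(deltaGraph_isHaar (deltaSymbol_injective le_rfl)).sixCycleCount_eq]
  simp only [alternatingSum_deltaSymbol_eq_zero_iff]
  rw [← Finset.coe_filter_univ, Set.ncard_coe_finset]
  revert a
  decide +kernel

theorem sixCycleCount_deltaGraph {n : ℕ} (hn : 4 ≤ n) (i : ZMod (3 * n)) (a : Fin 3) :
    sixCycleCount (deltaGraph n) s(.r i, .sr (i - deltaSymbol n a)) = ![3, 2, 3] a := by
  rw [(deltaGraph_isHaar (deltaSymbol_injective (by omega))).sixCycleCount_eq]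
  simp only [alternatingSum_deltaSymbol_eq_zero_iff,
    three_mul_dvd_combination_iff hn (abs_alternatingSum_coeffK_le _ _)]
  rw [← Finset.coe_filter_univ, Set.ncard_coe_finset]
  revert a
  decide +kernel

theorem delta_signature :
    (∀ v : DihedralGroup (3 * 3),
      Set.ncard {e ∈ (deltaGraph 3).incidenceSet v | sixCycleCount (deltaGraph 3) e = 4} = 1 ∧
      Set.ncard {e ∈ (deltaGraph 3).incidenceSet v | sixCycleCount (deltaGraph 3) e = 5} = 2) ∧
    ∀ n : ℕ, 4 ≤ n → ∀ v : DihedralGroup (3 * n),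
      Set.ncard {e ∈ (deltaGraph n).incidenceSet v | sixCycleCount (deltaGraph n) e = 2} = 1 ∧
      Set.ncard {e ∈ (deltaGraph n).incidenceSet v | sixCycleCount (deltaGraph n) e = 3} = 2 := by
  refine ⟨fun v => ?_, fun n hn v => ?_⟩
  · have h := (deltaGraph_isHaar (deltaSymbol_injective le_rfl)).ncard_incidenceSet
      sixCycleCount_deltaGraph_three v
    exact ⟨(h 4).trans (by decide), (h 5).trans (by decide)⟩
  · have h := (deltaGraph_isHaar (deltaSymbol_injective (by omega))).ncard_incidenceSet
      (sixCycleCount_deltaGraph hn) v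
    exact ⟨(h 2).trans (by decide), (h 3).trans (by decide)⟩
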